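/- For every k ∈ {5, 13, 77, 133, 141}, every n > 3, and every update order ω on ZMod n, every periodic state of the ACA map [k,ω]_n is a fixed point of [k,ω]_n; consequently Wolfram rule k is ω-independent. -/

import Mathlib

/-- State of the ACA: a cyclic binary string indexed by `ZMod n`. -/
abbrev AcaState (n : ℕ) := ZMod n → Fin 2

/-- Wolfram rule `k` applied at vertex `i`: update coordinate `i` to the binary
digit `a_j` of `k`, where `j = 4·y(i-1) + 2·y(i) + y(i+1)`. -/
def wolfRule (n k : ℕ) (i : ZMod n) (y : AcaState n) : AcaState n :=
  Function.update y i
    (if Nat.testBit k (4 * (y (i - 1)).val + 2 * (y i).val + (y (i + 1)).val)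
     then 1 else 0)

/-- The ACA map `[k,ω]ₙ = Wolf_{ω_m} ∘ ⋯ ∘ Wolf_{ω_1}`. -/
def acaMap (n k : ℕ) (ω : List (ZMod n)) (y : AcaState n) : AcaState n :=
  ω.foldl (fun s i => wolfRule n k i s) y

/-- An update order: a list containing every vertex at least once. -/
def IsUpdateOrder (n : ℕ) (ω : List (ZMod n)) : Prop :=
  ∀ v : ZMod n, v ∈ ω

/-- A simple update order: a list containing every vertex exactly once. -/
def IsSimpleUpdateOrder (n : ℕ) (ω : List (ZMod n)) : Prop :=
  ω.Nodup ∧ ∀ v : ZMod n, v ∈ ω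

/-- `y` is periodic for `F` if some positive iterate of `F` returns `y` to itself. -/
def IsPeriodicState {α : Type*} (F : α → α) (y : α) : Prop :=
  ∃ m : ℕ, 1 ≤ m ∧ F^[m] y = y

/-- `Per[k,ω]ₙ`: the set of periodic states of the ACA map. -/
def perSet (n k : ℕ) (ω : List (ZMod n)) : Set (AcaState n) :=
  {y | IsPeriodicState (acaMap n k ω) y}

/-- Rule `k` is ω-independent on `Circ n`. -/
def OmegaIndepOn (n k : ℕ) : Prop :=
  ∀ ω ω' : List (ZMod n), IsUpdateOrder n ω → IsUpdateOrder n ω' →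
    perSet n k ω = perSet n k ω'

/-- Rule `k` is ω-independent: ω-independent on `Circ n` for every `n > 3`. -/
def OmegaIndep (k : ℕ) : Prop :=
  ∀ n : ℕ, 3 < n → OmegaIndepOn n k

/-- The number of ones of `y` minus twice its number of adjacent pairs of ones. -/
def acaPotential (n : ℕ) [NeZero n] (y : AcaState n) : ℤ :=
  ∑ j : ZMod n, ((y j : ℤ) - 2 * (y j : ℤ) * (y (j + 1) : ℤ))

lemma acaPotential_update_sub (n : ℕ) [NeZero n] [Nontrivial (ZMod n)] (y : AcaState n)
    (i : ZMod n) (v : Fin 2) :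
    acaPotential n (Function.update y i v) - acaPotential n y =
      ((v : ℤ) - (y i : ℤ)) * (1 - 2 * (y (i - 1) : ℤ) - 2 * (y (i + 1) : ℤ)) := by
  have hsucc : i + 1 ≠ i := by simp
  have hpred : i - 1 ≠ i := by simp
  unfold acaPotential
  rw [← Finset.sum_sub_distrib, Finset.sum_eq_add i (i - 1) hpred.symm]
  · simp only [Function.update_self, Function.update_of_ne hsucc, Function.update_of_ne hpred,
      sub_add_cancel]
    ring
  · rintro j - ⟨hj, hj'⟩
    have hjs : j + 1 ≠ i := fun h => hj' (eq_sub_of_add_eq h)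
    simp [Function.update_of_ne hj, Function.update_of_ne hjs]
  · simp
  · simp

lemma acaPotential_lt_wolfRule {n k : ℕ} [NeZero n] [Nontrivial (ZMod n)]
    (hk : k ∈ ({5, 13, 77, 133, 141} : Set ℕ)) (i : ZMod n) (y : AcaState n)
    (h : wolfRule n k i y ≠ y) :
    acaPotential n y < acaPotential n (wolfRule n k i y) := by
  rw [← sub_pos]
  unfold wolfRule at h ⊢
  rw [acaPotential_update_sub]
  rw [Ne, Function.update_eq_self_iff] at h
  generalize y (i - 1) = a at *
  generalize y i = b at *
  generalize y (i + 1) = c at *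
  simp only [Set.mem_insert_iff, Set.mem_singleton_iff] at hk
  rcases hk with rfl | rfl | rfl | rfl | rfl <;> revert a b c <;> decide

lemma acaMap_cons (n k : ℕ) (i : ZMod n) (ω : List (ZMod n)) (y : AcaState n) :
    acaMap n k (i :: ω) y = acaMap n k ω (wolfRule n k i y) := rfl

lemma acaMap_eq_self_of_forall {n k : ℕ} {ω : List (ZMod n)} {y : AcaState n}
    (h : ∀ i ∈ ω, wolfRule n k i y = y) : acaMap n k ω y = y := by
  induction ω with
  | nil => rfl
  | cons i ω ih =>
    rw [acaMap_cons, h i List.mem_cons_self]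
    exact ih fun j hj => h j (List.mem_cons_of_mem i hj)

lemma acaPotential_lt_acaMap_or {n k : ℕ} [NeZero n] [Nontrivial (ZMod n)]
    (hk : k ∈ ({5, 13, 77, 133, 141} : Set ℕ)) (ω : List (ZMod n)) (y : AcaState n) :
    acaPotential n y < acaPotential n (acaMap n k ω y) ∨ ∀ i ∈ ω, wolfRule n k i y = y := by
  induction ω generalizing y with
  | nil => simp
  | cons i ω ih =>
    rw [acaMap_cons]
    by_cases h : wolfRule n k i y = y
    · rw [h]
      simpa [h] using ih y
    · left
      have hlt := acaPotential_lt_wolfRule hk i y h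
      rcases ih (wolfRule n k i y) with h' | h'
      · exact hlt.trans h'
      · rwa [acaMap_eq_self_of_forall h']

lemma acaPotential_le_acaMap {n k : ℕ} [NeZero n] [Nontrivial (ZMod n)]
    (hk : k ∈ ({5, 13, 77, 133, 141} : Set ℕ)) (ω : List (ZMod n)) (y : AcaState n) :
    acaPotential n y ≤ acaPotential n (acaMap n k ω y) := by
  rcases acaPotential_lt_acaMap_or hk ω y with h | h
  · exact h.le
  · rw [acaMap_eq_self_of_forall h]

lemma acaPotential_le_iterate {n k : ℕ} [NeZero n] [Nontrivial (ZMod n)]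
    (hk : k ∈ ({5, 13, 77, 133, 141} : Set ℕ)) (ω : List (ZMod n)) (m : ℕ) (y : AcaState n) :
    acaPotential n y ≤ acaPotential n ((acaMap n k ω)^[m] y) := by
  induction m generalizing y with
  | zero => rfl
  | succ m ih => exact (acaPotential_le_acaMap hk ω y).trans (ih _)

lemma mem_perSet_iff {n k : ℕ} [NeZero n] [Nontrivial (ZMod n)]
    (hk : k ∈ ({5, 13, 77, 133, 141} : Set ℕ)) (ω : List (ZMod n)) (y : AcaState n) :
    y ∈ perSet n k ω ↔ ∀ i ∈ ω, wolfRule n k i y = y := by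
  constructor
  · rintro ⟨m, hm, hy⟩
    refine (acaPotential_lt_acaMap_or hk ω y).resolve_left fun hlt => ?_
    obtain ⟨m, rfl⟩ := Nat.exists_eq_succ_of_ne_zero (Nat.one_le_iff_ne_zero.mp hm)
    rw [Function.iterate_succ_apply] at hy
    have hle := acaPotential_le_iterate hk ω m (acaMap n k ω y)
    rw [hy] at hle
    exact hlt.not_ge hle
  · exact fun h => ⟨1, le_rfl, acaMap_eq_self_of_forall h⟩

/-- Rules 5, 13, 77, 133 and 141: all periodic states are fixed states, and
these rules are ω-independent. -/
theorem rules_C_omegaIndep (k : ℕ)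
    (hk : k ∈ ({5, 13, 77, 133, 141} : Set ℕ)) :
    (∀ n : ℕ, 3 < n → ∀ ω : List (ZMod n), IsUpdateOrder n ω →
      ∀ y ∈ perSet n k ω, acaMap n k ω y = y) ∧
    OmegaIndep k := by
  constructor
  · intro n hn ω _ y hy
    have : NeZero n := ⟨by omega⟩
    have : Fact (1 < n) := ⟨by omega⟩
    exact acaMap_eq_self_of_forall ((mem_perSet_iff hk ω y).mp hy)
  · intro n hn ω ω' hω hω'
    have : NeZero n := ⟨by omega⟩
    have : Fact (1 < n) := ⟨by omega⟩
    ext y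
    rw [mem_perSet_iff hk, mem_perSet_iff hk]
    exact ⟨fun h i _ => h i (hω i), fun h i _ => h i (hω' i)⟩
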